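/- Let Δ^L(Y) be the determinant of the d×d submatrix of x^L(Y) with rows ι(R) and columns 1,…,d. Then Δ^L(Y) = Σ_{p ∈ X_d(m,m′)} Q(p), the sum of the labels of all paths in X_d(m,m′). -/

import Mathlib

noncomputable section
open Matrix BigOperators

namespace CTypeMinors

/-- Standard basis vector of `ℂ^{2r}`, indexed by a natural number `a` (0-indexed):
`a = j - 1` encodes the unbarred element `j ∈ J`, and `a = 2r - j` encodes the barred
element `j̄ ∈ J` (this is the bijection `ι` shifted to be 0-indexed; the natural order
on `{0, …, 2r-1}` corresponds to the total order on `J`). -/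
def vv (r a : ℕ) : Fin (2*r) → ℂ := fun k => if (k : ℕ) = a then 1 else 0

/-- `v_j` for unbarred `j` (`1 ≤ j ≤ r`); note `vu r (r+1) = v_{r̄}`. -/
def vu (r j : ℕ) : Fin (2*r) → ℂ := vv r (j - 1)

/-- `v_{j̄}` for barred `j̄` (`1 ≤ j ≤ r`). -/
def vb (r j : ℕ) : Fin (2*r) → ℂ := vv r (2*r - j)

/-- The matrix `f_i` (`1 ≤ i ≤ r`): `f_i v_i = v_{i+1}`, `f_i v_{(i+1)‾} = v_{ī}`
(for `i = r` these two conditions both read `f_r v_r = v_{r̄}`), all other basis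
vectors are sent to `0`. -/
def fMat (r i : ℕ) : Matrix (Fin (2*r)) (Fin (2*r)) ℂ :=
  Matrix.of fun k l =>
    if ((l : ℕ) + 1 = i ∧ (k : ℕ) = i) ∨ ((l : ℕ) + i + 1 = 2*r ∧ (k : ℕ) + i = 2*r)
    then 1 else 0

/-- `e_i = f_iᵀ`. -/
def eMat (r i : ℕ) : Matrix (Fin (2*r)) (Fin (2*r)) ℂ := (fMat r i)ᵀ

/-- `x_i(t) = 1 + t e_i`. -/
def xMat (r i : ℕ) (t : ℂ) : Matrix (Fin (2*r)) (Fin (2*r)) ℂ := 1 + t • eMat r i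

/-- `y_i(t) = 1 + t f_i`. -/
def yMat (r i : ℕ) (t : ℂ) : Matrix (Fin (2*r)) (Fin (2*r)) ℂ := 1 + t • fMat r i

/-- `α_i^∨(c)`: diagonal, acting by `c` on `v_i, v_{(i+1)‾}`, by `c⁻¹` on
`v_{i+1}, v_{ī}`, and by `1` elsewhere (for `i = r`: by `c` on `v_r`, `c⁻¹` on `v_{r̄}`). -/
def alMat (r i : ℕ) (c : ℂ) : Matrix (Fin (2*r)) (Fin (2*r)) ℂ :=
  Matrix.diagonal fun k =>
    if (k : ℕ) + 1 = i ∨ (k : ℕ) + i + 1 = 2*r then c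
    else if (k : ℕ) = i ∨ (k : ℕ) + i = 2*r then c⁻¹
    else 1

/-- `x_{-i}(t) = y_i(t) ⬝ α_i^∨(t⁻¹)`. -/
def xmMat (r i : ℕ) (t : ℂ) : Matrix (Fin (2*r)) (Fin (2*r)) ℂ :=
  yMat r i t * alMat r i t⁻¹

/-- Entry of a `2r × 2r` matrix at (0-indexed) natural number indices. -/
def ent {r : ℕ} (X : Matrix (Fin (2*r)) (Fin (2*r)) ℂ) (a b : ℕ) : ℂ :=
  dotProduct (vv r a) (X.mulVec (vv r b))

/-- Ordered product `g 1 * g 2 * ⋯ * g n` of matrices. -/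
def oprod {N : ℕ} (g : ℕ → Matrix (Fin N) (Fin N) ℂ) (n : ℕ) : Matrix (Fin N) (Fin N) ℂ :=
  ((List.range n).map fun l => g (l + 1)).prod

/-- `x^L(Y) = (x_{-1}(Y_{1,1})⋯x_{-r}(Y_{1,r})) ⋯ x_{-1}(Y_{m,1})⋯x_{-d}(Y_{m,d})`. -/
def xL (r m d : ℕ) (Y : ℕ → ℕ → ℂ) : Matrix (Fin (2*r)) (Fin (2*r)) ℂ :=
  oprod (fun s => oprod (fun l => xmMat r l (Y s l)) (if s = m then d else r)) m

/-- The 0-indexed row `ι(R_i)` for `i : Fin d` (0-indexed `i`): the `i`-th entry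
of `R` is `v_{m'+1+i}` when `(i+1) + m' ≤ r` and `v_{(d-i)‾}` otherwise. -/
def rowR (r m' d i : ℕ) : ℕ := if i + 1 + m' ≤ r then m' + i else 2*r + i - d

/-- `Δ^L(Y)`: determinant of the `d × d` submatrix of `x^L(Y)` with rows `ι(R)` and
columns `1, …, d`. -/
def DeltaL (r m m' d : ℕ) (Y : ℕ → ℕ → ℂ) : ℂ :=
  (Matrix.of fun i j : Fin d => ent (xL r m d Y) (rowR r m' d (i : ℕ)) (j : ℕ)).det

/-- `C̄(l,k) = Y_{l,k-1}/Y_{l,k}`. -/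
def Cbar (Y : ℕ → ℕ → ℂ) (l k : ℕ) : ℂ := Y l (k - 1) / Y l k

/-- `C(l,k) = Y_{l,k+1}/Y_{l+1,k}`. -/
def Cc (Y : ℕ → ℕ → ℂ) (l k : ℕ) : ℂ := Y l (k + 1) / Y (l + 1) k

/-- `|·| : J → ℕ` in the 0-indexed natural encoding of `J`. -/
def absV (r p : ℕ) : ℕ := if p < r then p + 1 else 2*r - p


/-- The condition of Definition 6.2: `A` encodes a path
`vt(m; a^{(0)}) → vt(m-1; a^{(1)}) → ⋯ → vt(0; a^{(m)})` in `X_d(m,m')`, where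
`A s i` is the 0-indexed natural encoding of `a^{(s)}_{i+1} ∈ J`. -/
def pathCond (r m m' d : ℕ) (A : Fin (m+1) → Fin d → Fin (2*r)) : Prop :=
  (∀ (s : Fin (m+1)) (i j : Fin d), i < j → A s i < A s j) ∧
  (∀ (s : Fin m) (i : Fin d),
      ((A s.castSucc i : ℕ) + 1 < r →
        (A s.succ i = A s.castSucc i ∨ (A s.succ i : ℕ) = (A s.castSucc i : ℕ) + 1)) ∧
      (A s.castSucc i : ℕ) ≤ (A s.succ i : ℕ)) ∧
  (∀ i : Fin d, (A 0 i : ℕ) = (i : ℕ) ∧ (A (Fin.last m) i : ℕ) = rowR r m' d (i : ℕ)) ∧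
  (∀ (s : Fin m) (i j : Fin d), (i : ℕ) + 1 = (j : ℕ) →
      r ≤ (A s.succ i : ℕ) → absV r (A s.castSucc j : ℕ) < absV r (A s.succ i : ℕ))

/-- The label `Q(p) = ∏_{s=0}^{m-1} Q^{(s)}(p)` of a path (Definition 6.4). -/
def Qpath (r m d : ℕ) (Y : ℕ → ℕ → ℂ) (A : Fin (m+1) → Fin d → Fin (2*r)) : ℂ :=
  ∏ s : Fin m, ∏ i : Fin d,
    (if (A s.castSucc i : ℕ) < r
     then (if (A s.succ i : ℕ) < r
           then Y (m - (s : ℕ)) (A s.succ i : ℕ) / Y (m - (s : ℕ)) ((A s.castSucc i : ℕ) + 1)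
           else 1 / Y (m - (s : ℕ)) (2*r - (A s.succ i : ℕ) - 1))
     else Y (m - (s : ℕ)) (2*r - (A s.castSucc i : ℕ)) /
            Y (m - (s : ℕ)) (2*r - (A s.succ i : ℕ) - 1))

/-- Expansion of the determinant of a product over all tuples of intermediate indices. -/
theorem det_mul_eq_sum_tuples {d N : ℕ} (A : Matrix (Fin d) (Fin N) ℂ)
    (B : Matrix (Fin N) (Fin d) ℂ) :
    (A * B).det = ∑ f : Fin d → Fin N, (A.submatrix id f).det * ∏ i, B (f i) i := by
  simp only [Matrix.det_apply', Matrix.mul_apply, Finset.prod_univ_sum, Fintype.piFinset_univ,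
    Finset.mul_sum, Finset.sum_mul]
  rw [Finset.sum_comm]
  refine Finset.sum_congr rfl fun f _ => Finset.sum_congr rfl fun σ _ => ?_
  simp [Finset.prod_mul_distrib, mul_assoc]

open Classical in
/-- The Cauchy–Binet formula. -/
theorem det_mul_eq_sum_strictMono {d N : ℕ} (A : Matrix (Fin d) (Fin N) ℂ)
    (B : Matrix (Fin N) (Fin d) ℂ) :
    (A * B).det = ∑ f : Fin d → Fin N,
      if StrictMono f then (A.submatrix id f).det * (B.submatrix f id).det else 0 := by
  rw [det_mul_eq_sum_tuples, ← Finset.sum_filter]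
  have hinj : ∑ f : Fin d → Fin N, (A.submatrix id f).det * ∏ i, B (f i) i =
      ∑ f : Fin d → Fin N with Function.Injective f,
        (A.submatrix id f).det * ∏ i, B (f i) i := by
    refine (Finset.sum_filter_of_ne fun f _ hf => ?_).symm
    by_contra hni
    obtain ⟨i, j, hij, hne⟩ := Function.not_injective_iff.mp hni
    exact hf (by rw [Matrix.det_zero_of_column_eq hne (by simp [hij]), zero_mul])
  have hexpand : ∀ g : Fin d → Fin N,
      (A.submatrix id g).det * (B.submatrix g id).det = ∑ σ : Equiv.Perm (Fin d),
        (A.submatrix id (g ∘ σ)).det * ∏ i, B ((g ∘ σ) i) i := by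
    intro g
    rw [Matrix.det_apply' (B.submatrix g id), Finset.mul_sum]
    refine Finset.sum_congr rfl fun σ _ => ?_
    have := Matrix.det_permute' σ (A.submatrix id g)
    rw [Matrix.submatrix_submatrix, Function.comp_id] at this
    rw [this]
    simp only [Matrix.submatrix_apply, Function.comp_apply, id]
    ring
  rw [hinj, Finset.sum_congr rfl fun g _ => hexpand g, ← Finset.sum_product']
  symm
  refine Finset.sum_bij (fun p _ => p.1 ∘ p.2) ?_ ?_ ?_ (fun _ _ => rfl)
  · rintro ⟨g, σ⟩ h
    simp only [Finset.mem_product, Finset.mem_filter, Finset.mem_univ, true_and, and_true] at h ⊢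
    exact h.injective.comp σ.injective
  · rintro ⟨g, σ⟩ h ⟨g', σ'⟩ h' heq
    simp only [Finset.mem_product, Finset.mem_filter, Finset.mem_univ, true_and, and_true]
      at h h' heq
    have e1 : (g ∘ σ) ∘ σ.symm = g := by ext; simp
    have e2 : (g ∘ σ) ∘ σ'.symm = g' := by rw [heq]; ext; simp
    have hg : g = g' := by
      have := Tuple.unique_monotone (f := g ∘ σ) (σ := σ.symm) (τ := σ'.symm)
        (by rw [e1]; exact h.monotone) (by rw [e2]; exact h'.monotone)
      rwa [e1, e2] at this
    subst hg
    refine Prod.ext rfl (Equiv.ext fun i => h.injective (congrFun heq i))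
  · intro f hf
    simp only [Finset.mem_filter, Finset.mem_univ, true_and] at hf
    refine ⟨(f ∘ Tuple.sort f, (Tuple.sort f).symm), ?_, by ext; simp⟩
    simp only [Finset.mem_product, Finset.mem_filter, Finset.mem_univ, true_and, and_true]
    exact (Tuple.monotone_sort f).strictMono_of_injective (hf.comp (Equiv.injective _))

theorem oprod_zero {N : ℕ} (g : ℕ → Matrix (Fin N) (Fin N) ℂ) : oprod g 0 = 1 := by
  simp [oprod]

theorem oprod_succ {N : ℕ} (g : ℕ → Matrix (Fin N) (Fin N) ℂ) (n : ℕ) :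
    oprod g (n + 1) = oprod g n * g (n + 1) := by
  simp [oprod, List.range_succ]

open Classical in
/-- A minor of an ordered product is a sum over chains of strictly increasing tuples. -/
theorem det_submatrix_oprod {d N : ℕ} (g : ℕ → Matrix (Fin N) (Fin N) ℂ) (n : ℕ)
    (R C : Fin d → Fin N) (hR : StrictMono R) (hC : StrictMono C) :
    ((oprod g n).submatrix R C).det = ∑ A : Fin (n + 1) → Fin d → Fin N,
      if (∀ s, StrictMono (A s)) ∧ A 0 = C ∧ A (Fin.last n) = R then
        ∏ s : Fin n, ((g (n - s)).submatrix (A s.succ) (A s.castSucc)).det else 0 := by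
  induction n generalizing C with
  | zero =>
    rw [oprod_zero, Fintype.sum_eq_single (fun _ => C)]
    · by_cases h : C = R
      · subst h
        simp [hC, Matrix.submatrix_one C hC.injective]
      · simp only [h, and_false, if_false]
        rw [Matrix.det_apply']
        refine Finset.sum_eq_zero fun σ _ => ?_
        by_contra hne
        have hprod : ∀ i, R (σ i) = C i := by
          intro i
          by_contra hi
          exact hne (by rw [Finset.prod_eq_zero (Finset.mem_univ i) (by simp [hi]),
            mul_zero])
        have hs : R ∘ σ = R ∘ (1 : Equiv.Perm (Fin d)) :=
          Tuple.unique_monotone (by rw [show R ∘ σ = C from funext hprod]; exact hC.monotone)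
            hR.monotone
        exact h (by rw [← show R ∘ σ = C from funext hprod, hs]; rfl)
    · intro A hA
      rw [if_neg]
      rintro ⟨-, h0, -⟩
      exact hA (funext fun s => by rw [Fin.fin_one_eq_zero s, h0])
  | succ n ih =>
    have hmul : (oprod g (n + 1)).submatrix R C =
        (oprod g n).submatrix R id * (g (n + 1)).submatrix id C := by
      rw [oprod_succ, Matrix.submatrix_mul _ _ R id C Function.bijective_id]
    have hterm : ∀ f : Fin d → Fin N,
        (if StrictMono f then (((oprod g n).submatrix R id).submatrix id f).det *
          (((g (n + 1)).submatrix id C).submatrix f id).det else 0) =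
        ∑ A : Fin (n + 1) → Fin d → Fin N, if f = A 0 then
          (if (∀ s, StrictMono (A s)) ∧ A (Fin.last n) = R then
            (∏ s : Fin n, ((g (n - s)).submatrix (A s.succ) (A s.castSucc)).det) *
              ((g (n + 1)).submatrix (A 0) C).det else 0) else 0 := by
      intro f
      split_ifs with hf
      · rw [Matrix.submatrix_submatrix, Matrix.submatrix_submatrix, Function.comp_id,
          Function.id_comp, Function.comp_id, ih f hf, Finset.sum_mul]
        refine Finset.sum_congr rfl fun A _ => ?_
        by_cases h : f = A 0
        · subst h
          simp only [true_and, if_true, ite_mul, zero_mul]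
        · rw [if_neg (fun hc => h hc.2.1.symm), if_neg h, zero_mul]
      · refine (Finset.sum_eq_zero fun A _ => ?_).symm
        split_ifs with h1 h2
        · exact absurd (h1 ▸ h2.1 0) hf
        · rfl
        · rfl
    rw [hmul, det_mul_eq_sum_strictMono, Finset.sum_congr rfl fun f _ => hterm f,
      Finset.sum_comm, ← (Fin.consEquiv (n := n + 1) fun _ => Fin d → Fin N).sum_comp, Fintype.sum_prod_type,
      Fintype.sum_eq_single C]
    · refine Finset.sum_congr rfl fun A _ => ?_
      rw [Finset.sum_ite_eq' Finset.univ (A 0), if_pos (Finset.mem_univ _)]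
      refine if_congr ?_ ?_ rfl
      · simp [Fin.forall_fin_succ (n := n + 1), Fin.consEquiv, hC, ← Fin.succ_last]
      · rw [Fin.prod_univ_succ, mul_comm]
        simp [Fin.consEquiv, Fin.castSucc_succ]
    · intro f hf
      refine Finset.sum_eq_zero fun A _ => if_neg ?_
      rintro ⟨-, h0, -⟩
      exact hf h0
/-- Admissible moves of a single vertex, in the 0-indexed encoding of `J`. -/
def StepAllowed (r a b : ℕ) : Prop := (a + 1 < r → b = a ∨ b = a + 1) ∧ a ≤ b

/-- The label of the move of a single vertex from `a` to `b`. -/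
def stepLabel (r : ℕ) (y : ℕ → ℂ) (a b : ℕ) : ℂ :=
  if a < r then (if b < r then y b / y (a + 1) else 1 / y (2 * r - b - 1))
  else y (2 * r - a) / y (2 * r - b - 1)

open Classical in
/-- The entry in row `b` and column `a` of `x_{-1}(y₁) ⋯ x_{-r}(y_r)`. -/
def stepEntry (r : ℕ) (y : ℕ → ℂ) (b a : ℕ) : ℂ :=
  if StepAllowed r a b then stepLabel r y a b else 0

theorem stepAllowed_of_stepEntry_ne_zero {r : ℕ} {y : ℕ → ℂ} {a b : ℕ}
    (h : stepEntry r y b a ≠ 0) : StepAllowed r a b := by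
  by_contra hn
  exact h (if_neg hn)

theorem det_stepEntry_of_interlacing {r d : ℕ} (y : ℕ → ℂ) {a b : Fin d → ℕ}
    (ha : StrictMono a) (hb : StrictMono b)
    (hab : ∀ i j : Fin d, (i : ℕ) + 1 = j → r ≤ b i → b i < a j) :
    (Matrix.of fun i j => stepEntry r y (b i) (a j)).det = ∏ i, stepEntry r y (b i) (a i) := by
  rw [Matrix.det_apply', Fintype.sum_eq_single 1]
  · simp
  intro σ hσ
  by_contra hne
  have hallow : ∀ i, StepAllowed r (a i) (b (σ i)) := fun i =>
    stepAllowed_of_stepEntry_ne_zero (y := y)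
      (Finset.prod_ne_zero_iff.mp (right_ne_zero_of_mul hne) i (Finset.mem_univ i))
  have hex : ∃ k : ℕ, ∃ h : k < d, σ ⟨k, h⟩ ≠ ⟨k, h⟩ := by
    by_contra! hc
    exact hσ (Equiv.ext fun i => hc i i.2)
  classical
  obtain ⟨hp, hpσ⟩ := Nat.find_spec hex
  set p : Fin d := ⟨Nat.find hex, hp⟩
  have hmin : ∀ i : Fin d, i < p → σ i = i := fun i hi => by
    have := Nat.find_min hex (m := i) hi
    push Not at this
    exact this i.2
  have hlt : ∀ i, i ≠ p → σ.symm i ≠ i → p < i := fun i hi hi' => by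
    by_contra hle
    have := hmin i (lt_of_le_of_ne (not_lt.mp hle) hi)
    exact hi' (by rw [Equiv.symm_apply_eq, this])
  have hσp : p < σ p := hlt _ hpσ (by simpa using hpσ.symm)
  obtain ⟨q, hq⟩ := σ.surjective p
  have hpq : p < q := by
    rcases lt_trichotomy q p with h | h | h
    · exact absurd (hmin q h ▸ hq) h.ne
    · exact absurd (h ▸ hq) hpσ
    · exact h
  have h1 := hallow p
  have h2 := hallow q
  have h3 := ha hpq
  have h4 := hb hσp
  rw [hq] at h2
  have hp1 : (p : ℕ) + 1 < d := by have := q.2; have : (p : ℕ) < q := hpq; omega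
  have h5 : a ⟨p + 1, hp1⟩ ≤ a q := ha.monotone (by rw [Fin.le_def]; exact hpq)
  have h6 := hab p ⟨p + 1, hp1⟩ rfl
  unfold StepAllowed at h1 h2
  omega

theorem det_stepEntry_of_not_interlacing {r d : ℕ} (y : ℕ → ℂ) {a b : Fin d → ℕ}
    (ha : StrictMono a) (hb : StrictMono b)
    (hab : ∃ i j : Fin d, (i : ℕ) + 1 = j ∧ r ≤ b i ∧ a j ≤ b i) :
    (Matrix.of fun i j => stepEntry r y (b i) (a j)).det = 0 := by
  classical
  obtain ⟨i, hi, hmax⟩ := Finset.exists_max_image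
    (Finset.univ.filter fun i : Fin d => ∃ j : Fin d, (i : ℕ) + 1 = j ∧ r ≤ b i ∧ a j ≤ b i)
    (fun i => i) (by obtain ⟨i, hi⟩ := hab; exact ⟨i, by simpa using hi⟩)
  simp only [Finset.mem_filter, Finset.mem_univ, true_and] at hi hmax
  obtain ⟨j, hij, hbi, haj⟩ := hi
  have hlt : i < j := by rw [Fin.lt_def]; omega
  have hbj := hb hlt
  have hzero : ∀ k : Fin d, j < k → b j < a k := by
    intro k hk
    have hj1 : (j : ℕ) + 1 < d := by have := k.2; have : (j : ℕ) < k := hk; omega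
    have h5 : a ⟨j + 1, hj1⟩ ≤ a k := ha.monotone (by rw [Fin.le_def]; exact hk)
    by_contra hle
    exact absurd (hmax j ⟨⟨j + 1, hj1⟩, rfl, by omega, by omega⟩) (not_le.mpr hlt)
  let w : ℕ → ℂ := fun c => 1 / y (2 * r - c - 1)
  let g : Fin d → ℂ := fun k =>
    if a k + 1 < r ∨ j < k then 0 else if a k < r then 1 else y (2 * r - a k)
  have hrow : ∀ c, r ≤ c → b i ≤ c → c ≤ b j → ∀ k, stepEntry r y c (a k) = w c * g k := by
    intro c hc hic hcj k
    simp only [stepEntry, stepLabel, w, g]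
    by_cases h1 : a k + 1 < r
    · rw [if_neg (by unfold StepAllowed; omega), if_pos (Or.inl h1), mul_zero]
    by_cases h2 : j < k
    · have := hzero k h2
      rw [if_neg (by unfold StepAllowed; omega), if_pos (Or.inr h2), mul_zero]
    have h3 : a k ≤ a j := ha.monotone (not_lt.mp h2)
    rw [if_pos (by unfold StepAllowed; omega), if_neg (show ¬ (a k + 1 < r ∨ j < k) by tauto),
      if_neg (show ¬ c < r by omega)]
    split_ifs
    · simp
    · ring
  have hM : (Matrix.of fun i j => stepEntry r y (b i) (a j)) =
      Matrix.of fun k l => (if k = i then w (b i) else if k = j then w (b j) else 1) *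
        (if k = i ∨ k = j then g l else stepEntry r y (b k) (a l)) := by
    ext k l
    simp only [Matrix.of_apply]
    by_cases hk : k = i
    · subst hk; simp [hrow _ hbi le_rfl hbj.le]
    by_cases hk' : k = j
    · subst hk'; simp [hk, hrow _ (hbi.trans hbj.le) hbj.le le_rfl]
    simp [hk, hk']
  rw [hM]
  refine (Matrix.det_mul_column _ (Matrix.of fun k l =>
    if k = i ∨ k = j then g l else stepEntry r y (b k) (a l))).trans ?_
  rw [Matrix.det_zero_of_row_eq hlt.ne (by ext l; simp), mul_zero]

open Classical in
theorem det_stepEntry {r d : ℕ} (y : ℕ → ℂ) {a b : Fin d → ℕ}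
    (ha : StrictMono a) (hb : StrictMono b) (ha' : ∀ i, a i < 2 * r) (hb' : ∀ i, b i < 2 * r) :
    (Matrix.of fun i j => stepEntry r y (b i) (a j)).det =
      if (∀ i, StepAllowed r (a i) (b i)) ∧
        (∀ i j : Fin d, (i : ℕ) + 1 = j → r ≤ b i → absV r (a j) < absV r (b i))
      then ∏ i, stepLabel r y (a i) (b i) else 0 := by
  have habs : (∀ i, StepAllowed r (a i) (b i)) →
      ∀ i j : Fin d, (i : ℕ) + 1 = j → r ≤ b i → (absV r (a j) < absV r (b i) ↔ b i < a j) := by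
    intro hs i j hij hr
    have h1 := hs i
    have h2 := ha (show i < j by rw [Fin.lt_def]; omega)
    have h3 := ha' j
    have h4 := hb' i
    unfold StepAllowed at h1
    unfold absV
    split_ifs <;> omega
  by_cases hs : ∀ i, StepAllowed r (a i) (b i)
  · by_cases hab : ∀ i j : Fin d, (i : ℕ) + 1 = j → r ≤ b i → b i < a j
    · rw [det_stepEntry_of_interlacing y ha hb hab,
        if_pos ⟨hs, fun i j hij hr => (habs hs i j hij hr).2 (hab i j hij hr)⟩]
      exact Finset.prod_congr rfl fun i _ => if_pos (hs i)
    · rw [if_neg fun h => hab fun i j hij hr => (habs hs i j hij hr).1 (h.2 i j hij hr)]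
      push Not at hab
      exact det_stepEntry_of_not_interlacing y ha hb hab
  · rw [if_neg fun h => hs h.1]
    by_cases hab : ∀ i j : Fin d, (i : ℕ) + 1 = j → r ≤ b i → b i < a j
    · rw [det_stepEntry_of_interlacing y ha hb hab]
      push Not at hs
      obtain ⟨i, hi⟩ := hs
      exact Finset.prod_eq_zero (Finset.mem_univ i) (if_neg hi)
    · push Not at hab
      exact det_stepEntry_of_not_interlacing y ha hb hab

theorem mul_xmMat_apply {r i : ℕ} (hi1 : 1 ≤ i) (hir : i ≤ r) (t : ℂ)
    (P : Matrix (Fin (2 * r)) (Fin (2 * r)) ℂ) (b a : Fin (2 * r)) :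
    (P * xmMat r i t) b a =
      (P b a + t * (if (a : ℕ) + 1 = i then P b ⟨i, by omega⟩
        else if (a : ℕ) + i + 1 = 2 * r then P b ⟨2 * r - i, by omega⟩ else 0)) *
      (if (a : ℕ) + 1 = i ∨ (a : ℕ) + i + 1 = 2 * r then t⁻¹
        else if (a : ℕ) = i ∨ (a : ℕ) + i = 2 * r then t else 1) := by
  have hf : (P * fMat r i) b a = if (a : ℕ) + 1 = i then P b ⟨i, by omega⟩
        else if (a : ℕ) + i + 1 = 2 * r then P b ⟨2 * r - i, by omega⟩ else 0 := by
    rw [Matrix.mul_apply]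
    split_ifs with h1 h2
    · rw [Fintype.sum_eq_single ⟨i, by omega⟩]
      · simp [fMat, h1]
      · intro k hk
        have : (k : ℕ) ≠ i := fun h => hk (Fin.ext h)
        simp only [fMat, Matrix.of_apply]
        rw [if_neg (by omega), mul_zero]
    · rw [Fintype.sum_eq_single ⟨2 * r - i, by omega⟩]
      · simp only [fMat, Matrix.of_apply]
        rw [if_pos (by omega), mul_one]
      · intro k hk
        have : (k : ℕ) ≠ 2 * r - i := fun h => hk (Fin.ext h)
        simp only [fMat, Matrix.of_apply]
        rw [if_neg (by omega), mul_zero]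
    · refine Finset.sum_eq_zero fun k _ => ?_
      simp only [fMat, Matrix.of_apply]
      rw [if_neg (by omega), mul_zero]
  rw [xmMat, ← Matrix.mul_assoc, alMat, Matrix.mul_diagonal, yMat, mul_add, mul_one,
    Matrix.mul_smul, Matrix.add_apply, Matrix.smul_apply, hf, inv_inv, smul_eq_mul]

/-- The entry in row `b` and column `a` of the partial product `x_{-1}(y₁) ⋯ x_{-n}(y_n)` for
`n < r`. -/
def partialEntry (r : ℕ) (y : ℕ → ℂ) (n b a : ℕ) : ℂ :=
  if a < r then
    if a < n then (if b = a then y a / y (a + 1) else if b = a + 1 then 1 else 0)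
    else if b = a then (if a = n then y n else 1) else 0
  else if 2 * r - a ≤ n + 1 then
    if a ≤ b then (if 2 * r - a ≤ n then y (2 * r - a) else 1) / y (2 * r - b - 1) else 0
  else if b = a then 1 else 0

theorem oprod_xmMat_apply_of_lt {r : ℕ} (y : ℕ → ℂ) (hy0 : y 0 = 1)
    (hy : ∀ l, 1 ≤ l → l ≤ r → y l ≠ 0) (n : ℕ) (hn : n < r) (b a : Fin (2 * r)) :
    oprod (fun l => xmMat r l (y l)) n b a = partialEntry r y n b a := by
  induction n generalizing b a with
  | zero =>
    have hb := b.2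
    have ha := a.2
    simp only [oprod_zero, Matrix.one_apply, Fin.ext_iff, partialEntry]
    by_cases h : (a : ℕ) < r
    · by_cases h' : (b : ℕ) = a <;> simp [h, h', hy0]
    · by_cases h1 : 2 * r - (a : ℕ) ≤ 1
      · have h2 : (a : ℕ) = 2 * r - 1 := by omega
        have h3 : 2 * r - (2 * r - 1) = 1 := by omega
        have h4 : ¬ (2 * r - 1 < r) := by omega
        by_cases h' : (b : ℕ) = a
        · simp [h', h2, h3, h4, hy0]
        · have : ¬ (2 * r - 1 ≤ (b : ℕ)) := by omega
          simp [h2 ▸ h', h2, h3, h4, this]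
      · simp [h, h1]
  | succ n ih =>
    have hb := b.2
    have ha := a.2
    have hyn := hy (n + 1) (by omega) (by omega)
    rw [oprod_succ, mul_xmMat_apply (by omega) (by omega), ih (by omega), ih (by omega),
      ih (by omega)]
    simp only [partialEntry]
    generalize (a : ℕ) = a' at *
    generalize (b : ℕ) = b' at *
    have hcases : a' < n ∨ a' = n ∨ a' = n + 1 ∨ (n + 1 < a' ∧ a' < r) ∨
        (r ≤ a' ∧ a' + n + 2 < 2 * r) ∨ a' + n + 2 = 2 * r ∨ a' + n + 1 = 2 * r ∨
        2 * r ≤ a' + n := by omega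
    rcases hcases with h | h | h | h | h | h | h | h
    · simp (disch := omega) only [if_pos, if_neg]
      simp
    · subst h
      simp (disch := omega) only [if_pos, if_neg]
      split_ifs <;> first | omega | tauto | (field_simp; try simp)
    · subst h
      simp (disch := omega) only [if_pos, if_neg]
      split_ifs <;> first | omega | tauto | simp
    · simp (disch := omega) only [if_pos, if_neg]
      simp
    · simp (disch := omega) only [if_pos, if_neg]
      simp
    · obtain rfl : a' = 2 * r - (n + 2) := by omega
      simp (disch := omega) only [if_pos, if_neg]
      split_ifs <;> first | omega | skip
      · rw [show 2 * r - b' - 1 = n + 1 by omega]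
        simp
      · field_simp
        simp
      · simp
    · obtain rfl : a' = 2 * r - (n + 1) := by omega
      simp (disch := omega) only [if_pos, if_neg]
      rw [show 2 * r - (2 * r - (n + 1)) = n + 1 by omega]
      split_ifs <;> first | omega | (field_simp; try simp)
    · simp (disch := omega) only [if_pos, if_neg]
      simp

theorem oprod_xmMat_apply {r : ℕ} (hr : 1 ≤ r) (y : ℕ → ℂ) (hy0 : y 0 = 1)
    (hy : ∀ l, 1 ≤ l → l ≤ r → y l ≠ 0) (b a : Fin (2 * r)) :
    oprod (fun l => xmMat r l (y l)) r b a = stepEntry r y b a := by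
  obtain ⟨n, rfl⟩ : ∃ n, r = n + 1 := ⟨r - 1, by omega⟩
  have hb := b.2
  have ha := a.2
  have hyn := hy (n + 1) (by omega) (by omega)
  rw [oprod_succ, mul_xmMat_apply (by omega) (by omega)]
  simp only [oprod_xmMat_apply_of_lt y hy0 hy n (by omega)]
  simp only [partialEntry, stepEntry, stepLabel, StepAllowed]
  generalize (a : ℕ) = a' at *
  generalize (b : ℕ) = b' at *
  have hcases : a' < n ∨ a' = n ∨ a' = n + 1 ∨ n + 1 < a' := by omega
  rcases hcases with h | h | h | h
  · simp (disch := omega) only [if_pos, if_neg]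
    split_ifs <;> first | omega | skip
    · subst b'
      simp
    · subst b'
      rw [div_self (hy _ (by omega) (by omega))]
      simp
    · simp
  · subst h
    simp (disch := omega) only [if_pos, if_neg]
    split_ifs <;> first | omega | skip
    · subst b'
      simp [div_eq_mul_inv]
    · field_simp
      simp
    · simp
  · subst h
    simp (disch := omega) only [if_pos, if_neg]
    split_ifs <;> first | omega | skip
    · rw [show 2 * (n + 1) - (n + 1) = n + 1 by omega]
      ring
    · simp
  · simp (disch := omega) only [if_pos, if_neg]
    split_ifs <;> first | omega | skip
    all_goals simp

theorem oprod_congr {N : ℕ} {g h : ℕ → Matrix (Fin N) (Fin N) ℂ} {n : ℕ}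
    (hgh : ∀ l, 1 ≤ l → l ≤ n → g l = h l) : oprod g n = oprod h n := by
  unfold oprod
  congr 1
  refine List.map_congr_left fun l hl => hgh _ (by omega) ?_
  have := List.mem_range.mp hl
  omega

/-- Factors `x_{-l}(1)` with `l > d` on the right do not change the first `d` columns. -/
theorem oprod_xmMat_apply_of_trivial {r d : ℕ} (y : ℕ → ℂ) (hy : ∀ l, d < l → y l = 1)
    (n : ℕ) (hdn : d ≤ n) (hnr : n ≤ r) (b a : Fin (2 * r)) (ha : (a : ℕ) < d) :
    oprod (fun l => xmMat r l (y l)) n b a = oprod (fun l => xmMat r l (y l)) d b a := by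
  induction n, hdn using Nat.le_induction with
  | base => rfl
  | succ n hdn ih =>
    rw [oprod_succ, mul_xmMat_apply (by omega) hnr, hy (n + 1) (by omega), ih (by omega)]
    simp (disch := omega) only [if_neg]
    simp

theorem ent_eq {r : ℕ} (X : Matrix (Fin (2 * r)) (Fin (2 * r)) ℂ) (a b : Fin (2 * r)) :
    ent X a b = X a b := by
  have hv : ∀ a : Fin (2 * r), vv r a = Pi.single a 1 := by
    intro a
    ext k
    simp [vv, Pi.single_apply, Fin.ext_iff]
  rw [ent, hv, hv, Matrix.mulVec_single_one, single_one_dotProduct, Matrix.col_apply]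

theorem rowR_lt {r m' d i : ℕ} (hi : i < d) (hdr : d ≤ r) : rowR r m' d i < 2 * r := by
  unfold rowR
  split_ifs <;> omega

theorem rowR_lt_rowR {r m' d i j : ℕ} (hij : i < j) (hdr : d ≤ r) :
    rowR r m' d i < rowR r m' d j := by
  unfold rowR
  split_ifs <;> omega

/-- The first `d` columns of `x^L(Y)` agree with those of a product of full blocks. -/
theorem xL_apply {r m d : ℕ} (hm : 1 ≤ m) (hdr : d ≤ r) (Y : ℕ → ℕ → ℂ)
    (hYm : ∀ l, d < l → Y m l = 1) (b a : Fin (2 * r)) (ha : (a : ℕ) < d) :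
    xL r m d Y b a = oprod (fun s => oprod (fun l => xmMat r l (Y s l)) r) m b a := by
  obtain ⟨k, rfl⟩ : ∃ k, m = k + 1 := ⟨m - 1, by omega⟩
  rw [xL, oprod_succ, oprod_succ, if_pos rfl, oprod_congr (n := k)
    (h := fun s => oprod (fun l => xmMat r l (Y s l)) r)
    (fun s _ hs => by rw [if_neg (by omega)]), Matrix.mul_apply, Matrix.mul_apply]
  refine Finset.sum_congr rfl fun c _ => ?_
  rw [oprod_xmMat_apply_of_trivial (Y (k + 1)) hYm r hdr le_rfl c a ha]

/- **Statement 1** (Proposition 6.8): `Δ^L(Y) = Σ_{p ∈ X_d(m,m')} Q(p)`. -/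
open Classical in
theorem deltaL_eq_sum_paths
    (r m m' d : ℕ) (hr : 2 ≤ r) (hm'1 : 1 ≤ m') (hm'm : m' ≤ m) (hmr : m ≤ r)
    (hd1 : 1 ≤ d) (hdr : d ≤ r)
    (Y : ℕ → ℕ → ℂ)
    (hY0 : ∀ s, Y s 0 = 1) (hYr1 : ∀ s, Y s (r+1) = 1) (hYm : ∀ l, d < l → Y m l = 1)
    (hYne : ∀ s l, 1 ≤ s → s ≤ m → 1 ≤ l → l ≤ r → Y s l ≠ 0) :
    DeltaL r m m' d Y =
      ∑ A : Fin (m+1) → Fin d → Fin (2*r),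
        if pathCond r m m' d A then Qpath r m d Y A else 0 := by
  let C : Fin d → Fin (2 * r) := fun i => ⟨i, by omega⟩
  let R : Fin d → Fin (2 * r) := fun i => ⟨rowR r m' d i, rowR_lt i.2 hdr⟩
  have hC : StrictMono C := fun i j hij => hij
  have hR : StrictMono R := fun i j hij => rowR_lt_rowR hij hdr
  have hΔ : DeltaL r m m' d Y =
      ((oprod (fun s => oprod (fun l => xmMat r l (Y s l)) r) m).submatrix R C).det := by
    rw [DeltaL]
    congr 1
    ext i j
    rw [Matrix.of_apply, Matrix.submatrix_apply,
      ← xL_apply (hm'1.trans hm'm) hdr Y hYm (R i) (C j) j.2]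
    exact ent_eq _ (R i) (C j)
  rw [hΔ, det_submatrix_oprod _ _ _ _ hR hC]
  refine Finset.sum_congr rfl fun A _ => ?_
  by_cases hmono : ∀ s, StrictMono (A s)
  swap
  · rw [if_neg fun h => hmono h.1, if_neg fun h => hmono fun s i j hij => h.1 s i j hij]
  have hstep : ∀ s : Fin m, ((oprod (fun l => xmMat r l (Y (m - s) l)) r).submatrix
      (A s.succ) (A s.castSucc)).det =
      if (∀ i, StepAllowed r (A s.castSucc i) (A s.succ i)) ∧
        (∀ i j : Fin d, (i : ℕ) + 1 = j → r ≤ (A s.succ i : ℕ) →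
          absV r (A s.castSucc j) < absV r (A s.succ i))
      then ∏ i, stepLabel r (Y (m - s)) (A s.castSucc i) (A s.succ i) else 0 := by
    intro s
    have hs := s.2
    rw [← det_stepEntry (r := r) (Y (m - s)) (a := fun i => (A s.castSucc i : ℕ))
      (b := fun i => (A s.succ i : ℕ)) (hmono _) (hmono _) (fun i => (A s.castSucc i).2)
      (fun i => (A s.succ i).2)]
    congr 1
    ext i j
    exact oprod_xmMat_apply (by omega) _ (hY0 _)
      (fun l h1 h2 => hYne _ l (by omega) (by omega) h1 h2) _ _
  rw [Finset.prod_congr rfl fun s _ => hstep s, Fintype.prod_ite_zero, ← ite_and]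
  congr 1
  simp only [pathCond, StepAllowed, funext_iff, Fin.ext_iff, C, R, eq_iff_iff]
  constructor
  · rintro ⟨⟨-, h0, h1⟩, h2⟩
    exact ⟨fun s i j hij => hmono s hij, fun s i => (h2 s).1 i, fun i => ⟨h0 i, h1 i⟩,
      fun s => (h2 s).2⟩
  · rintro ⟨-, h1, h2, h3⟩
    exact ⟨⟨hmono, fun i => (h2 i).1, fun i => (h2 i).2⟩, fun s => ⟨h1 s, h3 s⟩⟩

end CTypeMinors
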